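/- arXiv:1705.02792 — 10 statements merged into one kernel-verified Lean document; each statement's English description precedes it below -/
import Mathlib

section
/- Let s ∈ (0, 1/2) and r ∈ ℝ. In the exterior algebra over ℂ of a complex vector space with basis vectors ω¹, ω², ω³, ω̄¹, ω̄², ω̄³, set σ = (ω¹∧ω² + ω¹∧ω̄¹ − s²ω²∧ω̄²)∧ω̄³ − ω³∧(ω̄¹∧ω̄² − ω¹∧ω̄¹ + s²ω²∧ω̄²). Then σ ∧ (ω¹∧ω̄¹ + s²ω²∧ω̄² + r²ω³∧ω̄³) = 0. -/
/-- The metric `F_{s,r}` is balanced on `X^s`: `σ ∧ (ω¹ω̄¹ + s²ω²ω̄² + r²ω³ω̄³) = 0`.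
Indices: `0 = ω¹`, `1 = ω²`, `2 = ω³`, `3 = ω̄¹`, `4 = ω̄²`, `5 = ω̄³`. -/
theorem stmt_1 (s : ℝ) (hs : s ∈ Set.Ioo (0:ℝ) (1/2)) (r : ℝ)
    (V : Type*) [AddCommGroup V] [Module ℂ V] (b : Module.Basis (Fin 6) ℂ V) :
    let ω : Fin 6 → ExteriorAlgebra ℂ V := fun i => ExteriorAlgebra.ι ℂ (b i)
    let σ : ExteriorAlgebra ℂ V :=
      (ω 0 * ω 1 + ω 0 * ω 3 - ((s:ℂ)^2) • (ω 1 * ω 4)) * ω 5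
        - ω 2 * (ω 3 * ω 4 - ω 0 * ω 3 + ((s:ℂ)^2) • (ω 1 * ω 4))
    σ * (ω 0 * ω 3 + ((s:ℂ)^2) • (ω 1 * ω 4) + ((r:ℂ)^2) • (ω 2 * ω 5)) = 0 := by
  intro ω σ
  have sq : ∀ i, ω i * ω i = 0 := fun i => ExteriorAlgebra.ι_sq_zero (b i)
  have sq' : ∀ i t, ω i * (ω i * t) = 0 := fun i t => by rw [← mul_assoc, sq, zero_mul]
  have sw : ∀ i j, j < i → ω i * ω j = -(ω j * ω i) := fun i j _ =>
    eq_neg_of_add_eq_zero_left (ExteriorAlgebra.ι_add_mul_swap (b i) (b j))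
  have sw' : ∀ i j t, j < i → ω i * (ω j * t) = -(ω j * (ω i * t)) := fun i j t h => by
    rw [← mul_assoc, sw i j h, neg_mul, mul_assoc]
  clear_value ω
  simp (disch := decide) only [σ, mul_add, add_mul, mul_sub, sub_mul, smul_mul_assoc,
    mul_smul_comm, mul_assoc, sq, sq', sw, sw', mul_neg, neg_mul, neg_neg, mul_zero, smul_zero,
    smul_neg, neg_zero, smul_sub, smul_add]
  abel
end

section
/- Let s ∈ (0, 1/2). In the exterior algebra over ℂ of a complex vector space with basis vectors ω¹, ω², ω̄¹, ω̄², set ∂ = ω¹∧ω² + ω¹∧ω̄¹ − s²ω²∧ω̄² and ∂̄ = ω̄¹∧ω̄² − ω¹∧ω̄¹ + s²ω²∧ω̄². Then −(1/2)·[ (ω¹∧ω² − ω¹∧ω̄¹ + s²ω²∧ω̄²) ∧ ∂̄ + (ω¹∧ω̄¹ − s²ω²∧ω̄²) ∧ ∂ + ∂ ∧ ω̄¹∧ω̄² ] = (1 + 2s²) · ω¹∧ω̄¹∧ω²∧ω̄². In particular, this 4-vector is a positive real multiple of ω¹∧ω̄¹∧ω²∧ω̄². -/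
/-- The identity in any `ℂ`-algebra, for four pairwise anticommuting square-zero elements. -/
theorem aux_identity {A : Type*} [Ring A] [Algebra ℂ A] (t : ℂ) (x y z w : A)
    (hx : x * x = 0) (hy : y * y = 0) (hz : z * z = 0) (hw : w * w = 0)
    (yx : y * x = -(x * y)) (zx : z * x = -(x * z)) (wx : w * x = -(x * w))
    (zy : z * y = -(y * z)) (wy : w * y = -(y * w)) (wz : w * z = -(z * w)) :
    (-(1/2) : ℂ) • ((x * y - x * z + t • (y * w)) * (z * w - x * z + t • (y * w))
          + (x * z - t • (y * w)) * (x * y + x * z - t • (y * w))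
          + (x * y + x * z - t • (y * w)) * (z * w))
      = (1 + 2 * t) • (x * z * y * w) := by
  have cx (u : A) : x * (x * u) = 0 := by rw [← mul_assoc, hx, zero_mul]
  have cy (u : A) : y * (y * u) = 0 := by rw [← mul_assoc, hy, zero_mul]
  have cz (u : A) : z * (z * u) = 0 := by rw [← mul_assoc, hz, zero_mul]
  have cyx (u : A) : y * (x * u) = -(x * (y * u)) := by
    rw [← mul_assoc, yx, neg_mul, mul_assoc]
  have czx (u : A) : z * (x * u) = -(x * (z * u)) := by
    rw [← mul_assoc, zx, neg_mul, mul_assoc]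
  have cwx (u : A) : w * (x * u) = -(x * (w * u)) := by
    rw [← mul_assoc, wx, neg_mul, mul_assoc]
  have czy (u : A) : z * (y * u) = -(y * (z * u)) := by
    rw [← mul_assoc, zy, neg_mul, mul_assoc]
  have cwy (u : A) : w * (y * u) = -(y * (w * u)) := by
    rw [← mul_assoc, wy, neg_mul, mul_assoc]
  have cwz (u : A) : w * (z * u) = -(z * (w * u)) := by
    rw [← mul_assoc, wz, neg_mul, mul_assoc]
  simp only [mul_add, add_mul, mul_sub, sub_mul, smul_mul_assoc, mul_smul_comm, mul_assoc,
    hx, hy, hz, hw, yx, zx, wx, zy, wy, wz, cx, cy, cz, cyx, czx, cwx, czy, cwy, cwz,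
    mul_neg, neg_mul, neg_neg, mul_zero, neg_zero, smul_zero]
  module

/-- Computation of `dT_s` on `X^s`:
`-(1/2)·[(ω¹ω² − ω¹ω̄¹ + s²ω²ω̄²)∧∂̄ + (ω¹ω̄¹ − s²ω²ω̄²)∧∂ + ∂∧ω̄¹ω̄²] = (1+2s²)·ω¹ω̄¹ω²ω̄²`,
a positive real multiple of `ω¹∧ω̄¹∧ω²∧ω̄²`.
Indices: `0 = ω¹`, `1 = ω²`, `2 = ω̄¹`, `3 = ω̄²`. -/
theorem stmt_2 (s : ℝ) (hs : s ∈ Set.Ioo (0:ℝ) (1/2))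
    (V : Type*) [AddCommGroup V] [Module ℂ V] (b : Module.Basis (Fin 4) ℂ V) :
    let ω : Fin 4 → ExteriorAlgebra ℂ V := fun i => ExteriorAlgebra.ι ℂ (b i)
    let p : ExteriorAlgebra ℂ V := ω 0 * ω 1 + ω 0 * ω 2 - ((s:ℂ)^2) • (ω 1 * ω 3)
    let q : ExteriorAlgebra ℂ V := ω 2 * ω 3 - ω 0 * ω 2 + ((s:ℂ)^2) • (ω 1 * ω 3)
    ((-(1/2) : ℂ) • ((ω 0 * ω 1 - ω 0 * ω 2 + ((s:ℂ)^2) • (ω 1 * ω 3)) * q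
          + (ω 0 * ω 2 - ((s:ℂ)^2) • (ω 1 * ω 3)) * p
          + p * (ω 2 * ω 3))
      = ((1 + 2*(s:ℂ)^2)) • (ω 0 * ω 2 * ω 1 * ω 3))
    ∧ (∃ c : ℝ, 0 < c ∧
        (-(1/2) : ℂ) • ((ω 0 * ω 1 - ω 0 * ω 2 + ((s:ℂ)^2) • (ω 1 * ω 3)) * q
          + (ω 0 * ω 2 - ((s:ℂ)^2) • (ω 1 * ω 3)) * p
          + p * (ω 2 * ω 3))
      = (c : ℂ) • (ω 0 * ω 2 * ω 1 * ω 3)) := by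
  intro ω p q
  have sq (i : Fin 4) : ω i * ω i = 0 := ExteriorAlgebra.ι_sq_zero (b i)
  have anti (i j : Fin 4) : ω i * ω j = -(ω j * ω i) :=
    eq_neg_of_add_eq_zero_left (ExteriorAlgebra.ι_add_mul_swap (b i) (b j))
  have key := aux_identity ((s:ℂ)^2) (ω 0) (ω 1) (ω 2) (ω 3) (sq 0) (sq 1) (sq 2) (sq 3)
    (anti 1 0) (anti 2 0) (anti 3 0) (anti 2 1) (anti 3 1) (anti 3 2)
  refine ⟨key, 1 + 2 * s^2, by positivity, ?_⟩
  push_cast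
  exact key
end

section
/- Let s ∈ (0, 1/2). In the exterior algebra over ℝ of ℝ⁶ with basis e¹, …, e⁶ (write e^{ij} = e^i∧e^j, e^{1234} = e¹∧e²∧e³∧e⁴), define the 2-vectors: Ω¹₂ = −4(e^{12} − e^{34}) + (2/s)(e^{14} + e^{23}) + (2/s²)e^{34}; Ω¹₃ = Ω²₄ = −(1/s²)(e^{13} + e^{24}); Ω¹₄ = −Ω²₃ = −(1/s²)(e^{14} − e^{23}); Ω¹₅ = Ω²₆ = −(2/s)e^{46}; Ω¹₆ = −Ω²₅ = (2/s)e^{36}; Ω³₄ = 4(e^{12} − e^{34}) − (2/s)(e^{14} + e^{23}) + (2/s²)e^{12}; Ω³₅ = Ω⁴₆ = −(2/s)e^{26}; Ω³₆ = −Ω⁴₅ = (2/s)e^{16}; Ω⁵₆ = −Ω¹₂ − Ω³₄. Then Σ_{1≤i<j≤6} Ω^i_j ∧ Ω^i_j = −16(4s² + 1)/s² · e^{1234}. In particular, this sum is a negative real multiple of e^{1234}. -/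
theorem wedge_aux {A : Type*} [Ring A] [Algebra ℝ A] (s : ℝ) (hs : s ≠ 0) (e : Fin 6 → A)
    (sq : ∀ i, e i * e i = 0) (anti : ∀ i j, e i * e j = -(e j * e i)) :
    let E : Fin 6 → Fin 6 → A := fun i j => e i * e j
    let Ω12 : A :=
      (-4 : ℝ) • (E 0 1 - E 2 3) + (2/s) • (E 0 3 + E 1 2) + (2/s^2) • E 2 3
    let Ω13 := (-(1/s^2)) • (E 0 2 + E 1 3)
    let Ω24 := Ω13
    let Ω14 := (-(1/s^2)) • (E 0 3 - E 1 2)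
    let Ω23 := -Ω14
    let Ω15 := (-(2/s)) • E 3 5
    let Ω26 := Ω15
    let Ω16 := (2/s) • E 2 5
    let Ω25 := -Ω16
    let Ω34 : A :=
      (4 : ℝ) • (E 0 1 - E 2 3) - (2/s) • (E 0 3 + E 1 2) + (2/s^2) • E 0 1
    let Ω35 := (-(2/s)) • E 1 5
    let Ω46 := Ω35
    let Ω36 := (2/s) • E 0 5
    let Ω45 := -Ω36
    let Ω56 := -Ω12 - Ω34
    let S : A :=
      Ω12*Ω12 + Ω13*Ω13 + Ω14*Ω14 + Ω15*Ω15 + Ω16*Ω16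
        + Ω23*Ω23 + Ω24*Ω24 + Ω25*Ω25 + Ω26*Ω26
        + Ω34*Ω34 + Ω35*Ω35 + Ω36*Ω36 + Ω45*Ω45 + Ω46*Ω46 + Ω56*Ω56
    (S = (-16*(4*s^2+1)/s^2) • (e 0 * e 1 * e 2 * e 3)) := by
  have sq' : ∀ i x, e i * (e i * x) = 0 := fun i x => by rw [← mul_assoc, sq, zero_mul]
  have anti' : ∀ i j x, e i * (e j * x) = -(e j * (e i * x)) := fun i j x => by
    rw [← mul_assoc, anti, neg_mul, mul_assoc]
  intro E Ω12 Ω13 Ω24 Ω14 Ω23 Ω15 Ω26 Ω16 Ω25 Ω34 Ω35 Ω46 Ω36 Ω45 Ω56 S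
  simp only [S, Ω56, Ω45, Ω36, Ω46, Ω35, Ω34, Ω25, Ω16, Ω26, Ω15, Ω23, Ω14, Ω24, Ω13, Ω12, E]
  simp only [mul_add, add_mul, mul_sub, sub_mul, smul_add, smul_sub, smul_neg, neg_mul, mul_neg,
    smul_mul_assoc, mul_smul_comm, mul_assoc, sq, sq', mul_zero, smul_zero, neg_zero,
    anti 1 0, anti' 1 0, anti 2 0, anti' 2 0, anti 3 0, anti' 3 0, anti 5 0, anti' 5 0, anti 2
    1, anti' 2 1, anti 3 1, anti' 3 1, anti 5 1, anti' 5 1, anti 3 2, anti' 3 2, anti 5 2,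
    anti' 5 2, anti 5 3, anti' 5 3]
  match_scalars <;> field_simp <;> ring

/-- The trace `Σ_{1≤i<j≤6} Ω^i_j ∧ Ω^i_j` of the curvature of the
Strominger–Bismut connection of `(X^s, F_s)` equals `−16(4s²+1)/s² · e^{1234}`,
a negative real multiple of `e^{1234}`. -/
theorem stmt_3 (s : ℝ) (hs : s ∈ Set.Ioo (0:ℝ) (1/2))
    (b : Module.Basis (Fin 6) ℝ (Fin 6 → ℝ)) :
    let e : Fin 6 → ExteriorAlgebra ℝ (Fin 6 → ℝ) := fun i => ExteriorAlgebra.ι ℝ (b i)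
    let E : Fin 6 → Fin 6 → ExteriorAlgebra ℝ (Fin 6 → ℝ) := fun i j => e i * e j
    let Ω12 : ExteriorAlgebra ℝ (Fin 6 → ℝ) :=
      (-4 : ℝ) • (E 0 1 - E 2 3) + (2/s) • (E 0 3 + E 1 2) + (2/s^2) • E 2 3
    let Ω13 := (-(1/s^2)) • (E 0 2 + E 1 3)
    let Ω24 := Ω13
    let Ω14 := (-(1/s^2)) • (E 0 3 - E 1 2)
    let Ω23 := -Ω14
    let Ω15 := (-(2/s)) • E 3 5
    let Ω26 := Ω15
    let Ω16 := (2/s) • E 2 5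
    let Ω25 := -Ω16
    let Ω34 : ExteriorAlgebra ℝ (Fin 6 → ℝ) :=
      (4 : ℝ) • (E 0 1 - E 2 3) - (2/s) • (E 0 3 + E 1 2) + (2/s^2) • E 0 1
    let Ω35 := (-(2/s)) • E 1 5
    let Ω46 := Ω35
    let Ω36 := (2/s) • E 0 5
    let Ω45 := -Ω36
    let Ω56 := -Ω12 - Ω34
    let S : ExteriorAlgebra ℝ (Fin 6 → ℝ) :=
      Ω12*Ω12 + Ω13*Ω13 + Ω14*Ω14 + Ω15*Ω15 + Ω16*Ω16
        + Ω23*Ω23 + Ω24*Ω24 + Ω25*Ω25 + Ω26*Ω26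
        + Ω34*Ω34 + Ω35*Ω35 + Ω36*Ω36 + Ω45*Ω45 + Ω46*Ω46 + Ω56*Ω56
    (S = (-16*(4*s^2+1)/s^2) • (e 0 * e 1 * e 2 * e 3))
    ∧ (∃ c : ℝ, c < 0 ∧ S = c • (e 0 * e 1 * e 2 * e 3)) := by
  intro e E Ω12 Ω13 Ω24 Ω14 Ω23 Ω15 Ω26 Ω16 Ω25 Ω34 Ω35 Ω46 Ω36 Ω45 Ω56 S
  have h0 : 0 < s := hs.1
  have key : S = (-16*(4*s^2+1)/s^2) • (e 0 * e 1 * e 2 * e 3) :=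
    wedge_aux s h0.ne' e (fun i => ExteriorAlgebra.ι_sq_zero _)
      (fun i j => eq_neg_of_add_eq_zero_left (ExteriorAlgebra.ι_add_mul_swap _ _))
  refine ⟨key, _, ?_, key⟩
  apply div_neg_of_neg_of_pos <;> nlinarith [sq_nonneg s, pow_pos h0 2]
end

section
/- Let s ∈ (0, 1/2) and t ∈ ℂ with |t| < s². Set Δ = |t − |t|² − s²|², a(t) = (t − s²)(t̄(1 − t̄) − s²)/Δ, b(t) = −s²(t̄(1 − t) − s²)/Δ, c(t) = |t − s²|²(t(1 − t̄) − s²)/Δ (all well defined since |t| < s² implies t − s² ≠ 0 and t − |t|² − s² ≠ 0). In the exterior algebra over ℂ of a complex vector space with basis vectors ω¹, ω², ω̄¹, ω̄², set ω_t¹ = ω¹ + t ω̄², ω_t² = ω² + (t/(t − s²)) ω̄¹, ω̄_t¹ = ω̄¹ + t̄ ω², ω̄_t² = ω̄² + (t̄/(t̄ − s²)) ω¹. Then ω¹∧ω² + ω¹∧ω̄¹ − s²ω²∧ω̄² = a(t)·ω_t¹∧ω_t² + b(t)·ω_t¹∧ω̄_t¹ + c(t)·ω_t²∧ω̄_t².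 -/
/-- Structure equations of the deformed complex structure `J_t`:
`ω¹∧ω² + ω¹∧ω̄¹ − s²ω²∧ω̄² = a(t)ω_t¹∧ω_t² + b(t)ω_t¹∧ω̄_t¹ + c(t)ω_t²∧ω̄_t²`.
Indices: `0 = ω¹`, `1 = ω²`, `2 = ω̄¹`, `3 = ω̄²`. -/
theorem stmt_5 (s : ℝ) (hs : s ∈ Set.Ioo (0:ℝ) (1/2))
    (t : ℂ) (ht : ‖t‖ < s^2)
    (V : Type*) [AddCommGroup V] [Module ℂ V] (b : Module.Basis (Fin 4) ℂ V) :
    let Δ : ℝ := (‖t - ((‖t‖ : ℝ) : ℂ)^2 - (s:ℂ)^2‖)^2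
    let at' : ℂ := (t - (s:ℂ)^2) *
      ((starRingEnd ℂ) t * (1 - (starRingEnd ℂ) t) - (s:ℂ)^2) / (Δ : ℂ)
    let bt : ℂ := -(s:ℂ)^2 * ((starRingEnd ℂ) t * (1 - t) - (s:ℂ)^2) / (Δ : ℂ)
    let ct : ℂ := ((‖t - (s:ℂ)^2‖ : ℝ) : ℂ)^2 *
      (t * (1 - (starRingEnd ℂ) t) - (s:ℂ)^2) / (Δ : ℂ)
    let ω : Fin 4 → ExteriorAlgebra ℂ V := fun i => ExteriorAlgebra.ι ℂ (b i)
    let ωt1 := ω 0 + t • ω 3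
    let ωt2 := ω 1 + (t / (t - (s:ℂ)^2)) • ω 2
    let ωbt1 := ω 2 + ((starRingEnd ℂ) t) • ω 1
    let ωbt2 := ω 3 + ((starRingEnd ℂ) t / ((starRingEnd ℂ) t - (s:ℂ)^2)) • ω 0
    ω 0 * ω 1 + ω 0 * ω 2 - ((s:ℂ)^2) • (ω 1 * ω 3)
      = at' • (ωt1 * ωt2) + bt • (ωt1 * ωbt1) + ct • (ωt2 * ωbt2) := by
  intro Δ at' bt ct ω ωt1 ωt2 ωbt1 ωbt2
  have hre : t.re ≤ ‖t‖ := Complex.re_le_norm t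
  have hm : ((‖t‖ : ℝ) : ℂ)^2 = t * (starRingEnd ℂ) t := (Complex.mul_conj' t).symm
  have hB0 : t - ((‖t‖ : ℝ) : ℂ)^2 - (s:ℂ)^2 ≠ 0 := by
    intro h
    have h2 := congrArg Complex.re h
    have e : t - ((‖t‖ : ℝ) : ℂ)^2 - (s:ℂ)^2 = t - ((‖t‖^2 + s^2 : ℝ) : ℂ) := by
      push_cast; ring
    rw [e, Complex.sub_re, Complex.ofReal_re, Complex.zero_re] at h2
    nlinarith [sq_nonneg ‖t‖]
  have hp0 : t - (s:ℂ)^2 ≠ 0 := by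
    intro h
    have h2 := congrArg Complex.re h
    have e : t - (s:ℂ)^2 = t - ((s^2 : ℝ) : ℂ) := by push_cast; ring
    rw [e, Complex.sub_re, Complex.ofReal_re, Complex.zero_re] at h2
    linarith
  have hΔ : (Δ : ℂ) = (t - t * (starRingEnd ℂ) t - (s:ℂ)^2) *
      ((starRingEnd ℂ) t - t * (starRingEnd ℂ) t - (s:ℂ)^2) := by
    simp only [Δ]
    push_cast
    rw [← Complex.mul_conj', hm]
    simp only [map_sub, map_mul, map_pow, Complex.conj_conj, Complex.conj_ofReal]
    ring
  have hn : ((‖t - (s:ℂ)^2‖ : ℝ) : ℂ)^2 = (t - (s:ℂ)^2) * ((starRingEnd ℂ) t - (s:ℂ)^2) := by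
    rw [← Complex.mul_conj']
    simp only [map_sub, map_pow, Complex.conj_ofReal]
  have hq0 : (starRingEnd ℂ) t - (s:ℂ)^2 ≠ 0 := by
    intro h
    apply hp0
    have := congrArg (starRingEnd ℂ) h
    simpa only [map_sub, map_pow, Complex.conj_conj, Complex.conj_ofReal, map_zero] using this
  have hΔ0 : (Δ : ℂ) ≠ 0 := by
    simp only [Δ]
    exact_mod_cast pow_ne_zero 2 (norm_ne_zero_iff.mpr hB0)
  have anti : ∀ i j, ω i * ω j = - (ω j * ω i) := fun i j =>
    eq_neg_of_add_eq_zero_left (ExteriorAlgebra.ι_add_mul_swap (b i) (b j))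
  simp only [ωt1, ωt2, ωbt1, ωbt2, at', bt, ct, hn]
  clear_value ω
  generalize hD : (Δ : ℂ) = D at *
  generalize (starRingEnd ℂ) t = u at *
  generalize (s : ℂ)^2 = p at *
  simp only [mul_add, add_mul, smul_mul_assoc, mul_smul_comm, smul_add, smul_smul]
  rw [anti 3 1, anti 3 2, anti 1 0, anti 2 0]
  match_scalars <;> field_simp <;> rw [hΔ] <;> ring
end

section
/- Let s ∈ (0, 1/2) and let t = t₁ + i t₂ ∈ ℂ with |t| < s², so that t − t² − s² ≠ 0 and D(t) := −s²(t − |t|² − s²)² / |t − t² − s²|² is well defined. Then: (a) the imaginary part of D(t) vanishes if and only if t₂(t₁² + t₂² − t₁ + s²) = 0; (b) t₁² + t₂² − t₁ + s² > 0; consequently (c) D(t) is a real number if and only if t₂ = 0, i.e. if and only if t is real. -/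
/-- Reality of `D(t) = −s²(t−|t|²−s²)²/|t−t²−s²|²` for `|t| < s²`, `s ∈ (0,1/2)`:
(a) `Im D(t) = 0 ↔ t₂(t₁²+t₂²−t₁+s²) = 0`; (b) `t₁²+t₂²−t₁+s² > 0`;
(c) `D(t)` is real iff `t₂ = 0` (i.e. iff `t` is real). Also `t − t² − s² ≠ 0`. -/
theorem stmt_6 (s : ℝ) (hs : s ∈ Set.Ioo (0:ℝ) (1/2))
    (t : ℂ) (ht : ‖t‖ < s^2) :
    let D : ℂ := -(s:ℂ)^2 * (t - ((‖t‖ : ℝ) : ℂ)^2 - (s:ℂ)^2)^2 /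
      ((‖t - t^2 - (s:ℂ)^2‖ : ℝ) : ℂ)^2
    (t - t^2 - (s:ℂ)^2 ≠ 0)
    ∧ (D.im = 0 ↔ t.im * (t.re^2 + t.im^2 - t.re + s^2) = 0)
    ∧ (0 < t.re^2 + t.im^2 - t.re + s^2)
    ∧ (D.im = 0 ↔ t.im = 0) := by
  intro D
  obtain ⟨hs0, hs1⟩ := hs
  have hre : t.re < s^2 := lt_of_le_of_lt (Complex.re_le_norm t) ht
  have hs2 : s^2 < 1/4 := by nlinarith
  have hpos : 0 < t.re^2 + t.im^2 - t.re + s^2 := by nlinarith [sq_nonneg t.re, sq_nonneg t.im]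
  have hne : t - t^2 - (s:ℂ)^2 ≠ 0 := by
    intro h
    have h1 := congrArg Complex.re h
    have h2 := congrArg Complex.im h
    simp [pow_two] at h1 h2
    have h3 : t.im * (1 - 2 * t.re) = 0 := by linarith
    rcases mul_eq_zero.mp h3 with h4 | h4
    · rw [h4] at h1
      nlinarith [sq_nonneg t.re]
    · linarith
  have hN : 0 < ‖t - t^2 - (s:ℂ)^2‖ := norm_pos_iff.mpr hne
  have hnorm : ‖t‖^2 = t.re^2 + t.im^2 := by
    rw [Complex.sq_norm, Complex.normSq_apply]; ring
  have hD : D.im = 2 * s^2 * (t.im * (t.re^2 + t.im^2 - t.re + s^2)) /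
      ‖t - t^2 - (s:ℂ)^2‖^2 := by
    have h1 : D = (-(s:ℂ)^2 * (t - ((‖t‖^2 : ℝ) : ℂ) - (s:ℂ)^2)^2) /
        ((‖t - t^2 - (s:ℂ)^2‖^2 : ℝ) : ℂ) := by
      simp only [D]; push_cast; rfl
    rw [h1, Complex.div_ofReal_im, hnorm]
    congr 1
    rw [← Complex.ofReal_pow, ← Complex.ofReal_neg, Complex.im_ofReal_mul, pow_two (_ - _)]
    simp only [Complex.mul_im, Complex.sub_re, Complex.sub_im, Complex.ofReal_re,
      Complex.ofReal_im]
    ring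
  have ha : D.im = 0 ↔ t.im * (t.re^2 + t.im^2 - t.re + s^2) = 0 := by
    have h2 : 2 * s^2 ≠ 0 := by positivity
    rw [hD, div_eq_zero_iff, mul_eq_zero]
    simp only [h2, (pow_pos hN 2).ne', false_or, or_false]
  refine ⟨hne, ha, hpos, ?_⟩
  rw [ha, mul_eq_zero]
  simp only [hpos.ne', or_false]
end

section
/- Let s ∈ (0, 1/2) and t ∈ ℂ with |t| < s². With Δ = |t − |t|² − s²|², a(t) = (t − s²)(t̄(1 − t̄) − s²)/Δ, b(t) = −s²(t̄(1 − t) − s²)/Δ, c(t) = |t − s²|²(t(1 − t̄) − s²)/Δ (all well defined and with a(t) ≠ 0), one has conj(b(t))·c(t)/|a(t)|² = −s²(t − |t|² − s²)² / |t − t² − s²|². -/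
/-- Closed formula for `D(t) = conj(b(t))·c(t)/|a(t)|²`:
it equals `−s²(t−|t|²−s²)²/|t−t²−s²|²`; moreover `a(t) ≠ 0`. -/
theorem stmt_7 (s : ℝ) (hs : s ∈ Set.Ioo (0:ℝ) (1/2))
    (t : ℂ) (ht : ‖t‖ < s^2) :
    let Δ : ℝ := (‖t - ((‖t‖ : ℝ) : ℂ)^2 - (s:ℂ)^2‖)^2
    let at' : ℂ := (t - (s:ℂ)^2) *
      ((starRingEnd ℂ) t * (1 - (starRingEnd ℂ) t) - (s:ℂ)^2) / (Δ : ℂ)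
    let bt : ℂ := -(s:ℂ)^2 * ((starRingEnd ℂ) t * (1 - t) - (s:ℂ)^2) / (Δ : ℂ)
    let ct : ℂ := ((‖t - (s:ℂ)^2‖ : ℝ) : ℂ)^2 *
      (t * (1 - (starRingEnd ℂ) t) - (s:ℂ)^2) / (Δ : ℂ)
    (at' ≠ 0)
    ∧ ((starRingEnd ℂ) bt * ct / ((‖at'‖ : ℝ) : ℂ)^2
        = -(s:ℂ)^2 * (t - ((‖t‖ : ℝ) : ℂ)^2 - (s:ℂ)^2)^2 /
            ((‖t - t^2 - (s:ℂ)^2‖ : ℝ) : ℂ)^2) := by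
  obtain ⟨hs0, hs1⟩ := hs
  have hre : t.re ≤ ‖t‖ := Complex.re_le_norm t
  have hs4 : s ^ 2 < 1 / 4 := by nlinarith
  have h1 : t - (s:ℂ)^2 ≠ 0 := by
    intro h
    have := congrArg Complex.re h
    simp [← Complex.ofReal_pow] at this
    linarith
  have h2 : t - ((‖t‖ : ℝ) : ℂ)^2 - (s:ℂ)^2 ≠ 0 := by
    intro h
    have := congrArg Complex.re h
    simp only [← Complex.ofReal_pow, Complex.sub_re, Complex.ofReal_re, Complex.zero_re] at this
    nlinarith [sq_nonneg ‖t‖]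
  have h3 : t - t^2 - (s:ℂ)^2 ≠ 0 := by
    intro h
    have hr := congrArg Complex.re h
    have hi := congrArg Complex.im h
    simp only [← Complex.ofReal_pow, Complex.sub_re, Complex.ofReal_re, Complex.zero_re,
      Complex.sub_im, Complex.ofReal_im, Complex.zero_im, pow_two t, Complex.mul_re,
      Complex.mul_im] at hr hi
    have h0 : t.im * (1 - 2 * t.re) = 0 := by linarith
    rcases mul_eq_zero.mp h0 with h0 | h0
    · rw [h0] at hr
      nlinarith [sq_nonneg t.re]
    · linarith
  have hc : (starRingEnd ℂ) t * (1 - (starRingEnd ℂ) t) - (s:ℂ)^2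
      = (starRingEnd ℂ) (t - t^2 - (s:ℂ)^2) := by
    simp only [map_sub, map_pow, Complex.conj_ofReal]
    ring
  have hu : t * (1 - (starRingEnd ℂ) t) - (s:ℂ)^2 = t - ((‖t‖ : ℝ) : ℂ)^2 - (s:ℂ)^2 := by
    rw [← Complex.mul_conj']
    ring
  have hb : (starRingEnd ℂ) t * (1 - t) - (s:ℂ)^2
      = (starRingEnd ℂ) (t - ((‖t‖ : ℝ) : ℂ)^2 - (s:ℂ)^2) := by
    rw [← hu]
    simp
  intro Δ at' bt ct
  have hΔ : (Δ : ℂ) ≠ 0 := by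
    simp only [Δ]
    exact_mod_cast pow_ne_zero 2 (norm_ne_zero_iff.mpr h2)
  have hΔn : ‖(Δ : ℂ)‖ = Δ := by
    rw [Complex.norm_real, Real.norm_of_nonneg (sq_nonneg _)]
  have n1 : ((‖t - (s:ℂ)^2‖ : ℝ) : ℂ) ≠ 0 := by exact_mod_cast norm_ne_zero_iff.mpr h1
  have n3 : ((‖t - t^2 - (s:ℂ)^2‖ : ℝ) : ℂ) ≠ 0 := by exact_mod_cast norm_ne_zero_iff.mpr h3
  have ha : at' = (t - (s:ℂ)^2) * (starRingEnd ℂ) (t - t^2 - (s:ℂ)^2) / (Δ : ℂ) := by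
    rw [← hc]
  have hb' : (starRingEnd ℂ) bt
      = -(s:ℂ)^2 * (t - ((‖t‖ : ℝ) : ℂ)^2 - (s:ℂ)^2) / (Δ : ℂ) := by
    simp only [bt]
    rw [hb, map_div₀, map_mul, Complex.conj_conj, Complex.conj_ofReal, map_neg, map_pow,
      Complex.conj_ofReal]
  have hc' : ct = ((‖t - (s:ℂ)^2‖ : ℝ) : ℂ)^2 *
      (t - ((‖t‖ : ℝ) : ℂ)^2 - (s:ℂ)^2) / (Δ : ℂ) := by
    rw [← hu]
  have hn : ((‖at'‖ : ℝ) : ℂ) = ((‖t - (s:ℂ)^2‖ : ℝ) : ℂ) *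
      ((‖t - t^2 - (s:ℂ)^2‖ : ℝ) : ℂ) / (Δ : ℂ) := by
    rw [ha, norm_div, norm_mul, hΔn, Complex.norm_conj]
    push_cast
    rfl
  constructor
  · rw [ha]
    exact div_ne_zero (mul_ne_zero h1 ((map_ne_zero _).mpr h3)) hΔ
  · rw [hb', hc', hn]
    clear_value Δ
    generalize ((‖t - (s:ℂ)^2‖ : ℝ) : ℂ) = p at *
    generalize ((‖t - t^2 - (s:ℂ)^2‖ : ℝ) : ℂ) = q at *
    generalize t - ((‖t‖ : ℝ) : ℂ)^2 - (s:ℂ)^2 = u at *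
    field_simp
end

section
/- Let t ∈ ℂ with |t| < 1. In the exterior algebra over ℂ of a complex vector space with basis vectors η¹, η², η̄¹, η̄², set η_t¹ = η¹ + t η̄¹ − i t η̄², η_t² = η², η̄_t¹ = η̄¹ + t̄ η¹ + i t̄ η², η̄_t² = η̄². Then 2(1 − |t|²)·[ (i/2)η¹∧η̄¹ + (1/2)η¹∧η̄² + (1/2)η²∧η̄¹ ] = 2t̄·η_t¹∧η_t² + i·η_t¹∧η̄_t¹ + η_t¹∧η̄_t² + η_t²∧η̄_t¹ − i|t|²·η_t²∧η̄_t². -/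
/-- Structure equations of the deformation `X_t = (N, J_t)` of the nilmanifold
with Lie algebra `𝔥₄`. Indices: `0 = η¹`, `1 = η²`, `2 = η̄¹`, `3 = η̄²`. -/
theorem stmt_9 (t : ℂ) (ht : ‖t‖ < 1)
    (V : Type*) [AddCommGroup V] [Module ℂ V] (b : Module.Basis (Fin 4) ℂ V) :
    let η : Fin 4 → ExteriorAlgebra ℂ V := fun i => ExteriorAlgebra.ι ℂ (b i)
    let ηt1 := η 0 + t • η 2 - (Complex.I * t) • η 3
    let ηt2 := η 1
    let ηbt1 := η 2 + ((starRingEnd ℂ) t) • η 0 + (Complex.I * (starRingEnd ℂ) t) • η 1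
    let ηbt2 := η 3
    (2 * (1 - ((‖t‖ : ℝ) : ℂ)^2)) •
        ((Complex.I/2) • (η 0 * η 2) + (1/2 : ℂ) • (η 0 * η 3) + (1/2 : ℂ) • (η 1 * η 2))
      = (2 * (starRingEnd ℂ) t) • (ηt1 * ηt2) + Complex.I • (ηt1 * ηbt1)
          + ηt1 * ηbt2 + ηt2 * ηbt1
          - (Complex.I * ((‖t‖ : ℝ) : ℂ)^2) • (ηt2 * ηbt2) := by
  intro η ηt1 ηt2 ηbt1 ηbt2
  have sq : ∀ i, η i * η i = 0 := fun i => ExteriorAlgebra.ι_sq_zero (b i)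
  have anti : ∀ i j, η i * η j = -(η j * η i) := fun i j =>
    eq_neg_of_add_eq_zero_left (ExteriorAlgebra.ι_add_mul_swap (b i) (b j))
  have hN : ((‖t‖ : ℝ) : ℂ)^2 = t * (starRingEnd ℂ) t := by
    rw [Complex.mul_conj, Complex.normSq_eq_norm_sq]; push_cast; rfl
  have hI : Complex.I ^ 2 = -1 := Complex.I_sq
  rw [hN]
  simp only [ηt1, ηt2, ηbt1, ηbt2]
  generalize (starRingEnd ℂ) t = s
  generalize Complex.I = I at hI ⊢
  clear_value η
  simp only [add_mul, sub_mul, mul_add, smul_mul_assoc, mul_smul_comm, sq,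
    anti 1 0, anti 2 0, anti 3 0, anti 2 1, anti 3 1, anti 3 2]
  match_scalars
  all_goals first
    | ring1
    | linear_combination (-(t * s)) * hI
    | linear_combination (t * s) * hI
    | linear_combination (-s) * hI
    | linear_combination (-(s * I * t)) * hI
    | linear_combination (-t) * hI
end

section
/- Let t = t₁ + i t₂ ∈ ℂ with 0 < |t| < 1 and let r ∈ ℝ, r ≠ 0. In the exterior algebra over ℝ of ℝ⁶ with basis e¹, …, e⁶ (e^{ij} = e^i∧e^j), set m = r/(|t|(1 − |t|²)), D₅ = (r/(1 − |t|²))(e^{12} − e^{34}) + m t₁(e^{13} − e^{24}) + m t₂(e^{14} + e^{23}), and D₆ = −m t₂(e^{13} − e^{24}) − m(1 − t₁)e^{14} + m(1 + t₁)e^{23}. Then m·[ |t|·e^{12}∧D₅ − t₁·e^{13}∧D₅ + t₂·e^{13}∧D₆ − t₂·e^{14}∧D₅ − (1 + t₁)·e^{14}∧D₆ − t₂·e^{23}∧D₅ + (1 − t₁)·e^{23}∧D₆ + t₁·e^{24}∧D₅ − t₂·e^{24}∧D₆ − |t|·e^{34}∧D₅ ] = −(2r²(1 + 3|t|²)/(|t|²(1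 − |t|²)²))·e^{1234}. -/
/-- The identity in an algebra with four anticommuting square-zero elements. -/
theorem wedge_aux_s11 {A : Type*} [Ring A] [Algebra ℝ A] (x : Fin 6 → A)
    (hs : ∀ i, x i * x i = 0) (hc : ∀ i j, x j * x i = -(x i * x j))
    (c m a t1 t2 k : ℝ) (hc' : c = m * a) (ha : a ^ 2 = t1 ^ 2 + t2 ^ 2)
    (hk : k = -(2 * m ^ 2 * (1 + 3 * a ^ 2))) (D5 D6 : A)
    (h5 : D5 = c • (x 0 * x 1 - x 2 * x 3) + (m * t1) • (x 0 * x 2 - x 1 * x 3)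
        + (m * t2) • (x 0 * x 3 + x 1 * x 2))
    (h6 : D6 = -((m * t2) • (x 0 * x 2 - x 1 * x 3)) - (m * (1 - t1)) • (x 0 * x 3)
        + (m * (1 + t1)) • (x 1 * x 2)) :
    m • (a • (x 0 * x 1 * D5) - t1 • (x 0 * x 2 * D5) + t2 • (x 0 * x 2 * D6)
          - t2 • (x 0 * x 3 * D5) - (1 + t1) • (x 0 * x 3 * D6)
          - t2 • (x 1 * x 2 * D5) + (1 - t1) • (x 1 * x 2 * D6)
          + t1 • (x 1 * x 3 * D5) - t2 • (x 1 * x 3 * D6) - a • (x 2 * x 3 * D5))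
      = k • (x 0 * x 1 * x 2 * x 3) := by
  have hs' : ∀ i z, x i * (x i * z) = 0 := fun i z => by rw [← mul_assoc, hs, zero_mul]
  have hc2 : ∀ i j z, x j * (x i * z) = -(x i * (x j * z)) := fun i j z => by
    rw [← mul_assoc, hc, neg_mul, mul_assoc]
  subst h5 h6
  simp only [mul_add, mul_sub, mul_neg, mul_smul_comm, mul_assoc, hs, hs',
    hc 0 1, hc 0 2, hc 0 3, hc 1 2, hc 1 3, hc 2 3,
    hc2 0 1, hc2 0 2, hc2 0 3, hc2 1 2, hc2 1 3, hc2 2 3, mul_zero, neg_zero, smul_zero, neg_neg]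
  match_scalars
  subst hk hc'
  linear_combination (4 * m ^ 2) * ha

/-- Computation of `dT_{t,r} = −2r²(1+3|t|²)/(|t|²(1−|t|²)²)·e^{1234}` on the
deformation `X_t` of the nilmanifold with Lie algebra `𝔥₄`. -/
theorem stmt_11 (t : ℂ) (ht0 : 0 < ‖t‖) (ht1 : ‖t‖ < 1)
    (r : ℝ) (hr : r ≠ 0)
    (b : Module.Basis (Fin 6) ℝ (Fin 6 → ℝ)) :
    let e : Fin 6 → ExteriorAlgebra ℝ (Fin 6 → ℝ) := fun i => ExteriorAlgebra.ι ℝ (b i)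
    let E : Fin 6 → Fin 6 → ExteriorAlgebra ℝ (Fin 6 → ℝ) := fun i j => e i * e j
    let a : ℝ := ‖t‖
    let t1 : ℝ := t.re
    let t2 : ℝ := t.im
    let m : ℝ := r / (a * (1 - a^2))
    let D5 : ExteriorAlgebra ℝ (Fin 6 → ℝ) :=
      (r / (1 - a^2)) • (E 0 1 - E 2 3) + (m * t1) • (E 0 2 - E 1 3)
        + (m * t2) • (E 0 3 + E 1 2)
    let D6 : ExteriorAlgebra ℝ (Fin 6 → ℝ) :=
      -((m * t2) • (E 0 2 - E 1 3)) - (m * (1 - t1)) • E 0 3 + (m * (1 + t1)) • E 1 2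
    m • (a • (E 0 1 * D5) - t1 • (E 0 2 * D5) + t2 • (E 0 2 * D6)
          - t2 • (E 0 3 * D5) - (1 + t1) • (E 0 3 * D6)
          - t2 • (E 1 2 * D5) + (1 - t1) • (E 1 2 * D6)
          + t1 • (E 1 3 * D5) - t2 • (E 1 3 * D6) - a • (E 2 3 * D5))
      = (-(2 * r^2 * (1 + 3*a^2) / (a^2 * (1 - a^2)^2))) • (e 0 * e 1 * e 2 * e 3) := by
  intro e E a t1 t2 m D5 D6
  have h1 : a ≠ 0 := ht0.ne'
  have h2 : 1 - a ^ 2 ≠ 0 := by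
    have : a < 1 := ht1
    have : 0 < a := ht0
    nlinarith
  refine wedge_aux_s11 e (fun i => ExteriorAlgebra.ι_sq_zero _) (fun i j => ?_)
    (r / (1 - a ^ 2)) m a t1 t2 _ ?_ ?_ ?_ D5 D6 rfl rfl
  · exact eq_neg_of_add_eq_zero_left (ExteriorAlgebra.ι_add_mul_swap (b j) (b i))
  · simp only [m]
    field_simp
  · have := Complex.sq_norm t
    rw [Complex.normSq_apply] at this
    simp only [a, t1, t2]
    linarith
  · simp only [m]
    field_simp
end

section
/- Let t = t₁ + i t₂ ∈ ℂ with 0 < |t| < 1 and let r ∈ ℝ, r ≠ 0; set ρ = |t|²(1 − |t|²)²/r². In the exterior algebra over ℝ of ℝ⁶ with basis e¹, …, e⁶ (e^{ij} = e^i∧e^j), define: ρΩ¹₂ = −|t|²e^{12} − t₁|t|(e^{13} − e^{24}) − t₂|t|(e^{14} + e^{23}) + 3|t|²e^{34}; ρΩ¹₃ = −|t|²(e^{13} + e^{24}) + 2|t|e^{56}; ρΩ¹₄ = −t₂(e^{13} − e^{24}) − (1 − t₁ + |t|²)e^{14} + (1 + t₁ + |t|²)e^{23}; ρΩ¹₅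 = −t₂(e^{16} + |t|e^{35}) + t₁(e^{26} + |t|e^{45}); ρΩ¹₆ = −t₁(e^{16} + |t|e^{35}) − t₂(e^{26} + |t|e^{45}); ρΩ³₄ = 3|t|²e^{12} + t₁|t|(e^{13} − e^{24}) + t₂|t|(e^{14} + e^{23}) − |t|²e^{34}; ρΩ³₅ = −t₂(|t|e^{15} − e^{36}) + t₁(|t|e^{25} − e^{46}); ρΩ³₆ = −t₁(|t|e^{15} − e^{36}) − t₂(|t|e^{25} − e^{46}); together with Ω²₃ = −Ω¹₄, Ω²₄ = Ω¹₃, Ω²₅ = −Ω¹₆, Ω²₆ = Ω¹₅, Ω⁴₅ = −Ω³₆, Ω⁴₆ = Ω³₅, Ω⁵₆ = −Ω¹₂ − Ω³₄. Then Σ_{1≤i<j≤6} Ω^i_j ∧ Ω^i_j = −(4r⁴(1 + |t|² + 2|t|⁴)/(|t|⁴(1 − |t|²)⁴))·e^{1234}. In particular, this sum is a negative real multiple of e^{1234}. -/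
/-- The purely algebraic expansion, before inserting the value of the scale. -/
theorem sum_gen {A : Type*} [Ring A] [Algebra ℝ A] (x : Fin 6 → A)
    (hs : ∀ i, x i * x i = 0) (ha : ∀ i j, j < i → x i * x j = -(x j * x i))
    (a t1 t2 m : ℝ) (h : t2 ^ 2 = a ^ 2 - t1 ^ 2) :
    let E : Fin 6 → Fin 6 → A := fun i j => x i * x j
    let Ω12 : A := m •
      (-(a^2) • E 0 1 - (t1 * a) • (E 0 2 - E 1 3) - (t2 * a) • (E 0 3 + E 1 2)
        + (3 * a^2) • E 2 3)
    let Ω13 : A := m •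
      (-(a^2) • (E 0 2 + E 1 3) + (2 * a) • E 4 5)
    let Ω14 : A := m •
      (-(t2) • (E 0 2 - E 1 3) - (1 - t1 + a^2) • E 0 3 + (1 + t1 + a^2) • E 1 2)
    let Ω15 : A := m •
      (-(t2) • (E 0 5 + a • E 2 4) + t1 • (E 1 5 + a • E 3 4))
    let Ω16 : A := m •
      (-(t1) • (E 0 5 + a • E 2 4) - t2 • (E 1 5 + a • E 3 4))
    let Ω34 : A := m •
      ((3 * a^2) • E 0 1 + (t1 * a) • (E 0 2 - E 1 3) + (t2 * a) • (E 0 3 + E 1 2)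
        - (a^2) • E 2 3)
    let Ω35 : A := m •
      (-(t2) • (a • E 0 4 - E 2 5) + t1 • (a • E 1 4 - E 3 5))
    let Ω36 : A := m •
      (-(t1) • (a • E 0 4 - E 2 5) - t2 • (a • E 1 4 - E 3 5))
    let Ω23 := -Ω14
    let Ω24 := Ω13
    let Ω25 := -Ω16
    let Ω26 := Ω15
    let Ω45 := -Ω36
    let Ω46 := Ω35
    let Ω56 := -Ω12 - Ω34
    let S : A :=
      Ω12*Ω12 + Ω13*Ω13 + Ω14*Ω14 + Ω15*Ω15 + Ω16*Ω16
        + Ω23*Ω23 + Ω24*Ω24 + Ω25*Ω25 + Ω26*Ω26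
        + Ω34*Ω34 + Ω35*Ω35 + Ω36*Ω36 + Ω45*Ω45 + Ω46*Ω46 + Ω56*Ω56
    S = (-(m ^ 2 * (4 * (1 + a^2 + 2*a^4)))) • (x 0 * x 1 * x 2 * x 3) := by
  have hs' : ∀ i y, x i * (x i * y) = 0 := fun i y => by rw [← mul_assoc, hs, zero_mul]
  have ha' : ∀ i j, j < i → ∀ y, x i * (x j * y) = -(x j * (x i * y)) := fun i j h y => by
    rw [← mul_assoc, ha i j h, neg_mul, mul_assoc]
  have e10 := ha 1 0 (by decide)
  have f10 := ha' 1 0 (by decide)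
  have e20 := ha 2 0 (by decide)
  have f20 := ha' 2 0 (by decide)
  have e21 := ha 2 1 (by decide)
  have f21 := ha' 2 1 (by decide)
  have e30 := ha 3 0 (by decide)
  have f30 := ha' 3 0 (by decide)
  have e31 := ha 3 1 (by decide)
  have f31 := ha' 3 1 (by decide)
  have e32 := ha 3 2 (by decide)
  have f32 := ha' 3 2 (by decide)
  have e40 := ha 4 0 (by decide)
  have f40 := ha' 4 0 (by decide)
  have e41 := ha 4 1 (by decide)
  have f41 := ha' 4 1 (by decide)
  have e42 := ha 4 2 (by decide)
  have f42 := ha' 4 2 (by decide)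
  have e43 := ha 4 3 (by decide)
  have f43 := ha' 4 3 (by decide)
  have e50 := ha 5 0 (by decide)
  have f50 := ha' 5 0 (by decide)
  have e51 := ha 5 1 (by decide)
  have f51 := ha' 5 1 (by decide)
  have e52 := ha 5 2 (by decide)
  have f52 := ha' 5 2 (by decide)
  have e53 := ha 5 3 (by decide)
  have f53 := ha' 5 3 (by decide)
  have e54 := ha 5 4 (by decide)
  have f54 := ha' 5 4 (by decide)
  intro E Ω12 Ω13 Ω14 Ω15 Ω16 Ω34 Ω35 Ω36 Ω23 Ω24 Ω25 Ω26 Ω45 Ω46 Ω56 S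
  simp only [S, Ω23, Ω24, Ω25, Ω26, Ω45, Ω46, Ω56, Ω12, Ω13, Ω14, Ω15, Ω16, Ω34, Ω35, Ω36, E]
  simp only [neg_smul, mul_add, add_mul, mul_sub, sub_mul, smul_add, smul_sub, smul_neg,
    smul_mul_assoc, mul_smul_comm, mul_assoc, neg_mul, hs, hs',
    e10, f10, e20, f20, e21, f21, e30, f30, e31, f31, e32, f32, e40, f40, e41, f41, e42, f42, e43, f43, e50, f50, e51, f51, e52, f52, e53, f53, e54, f54,
    mul_neg, mul_zero, neg_zero, neg_neg, smul_zero]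
  match_scalars <;> ring_nf <;> simp only [h, show t2 ^ 4 = (a ^ 2 - t1 ^ 2) ^ 2 by rw [← h]; ring] <;> ring

/-- The trace `Σ_{1≤i<j≤6} Ω^i_j ∧ Ω^i_j` of the curvature of the
Strominger–Bismut connection of `(X_t, F_{t,r})` equals
`−4r⁴(1+|t|²+2|t|⁴)/(|t|⁴(1−|t|²)⁴)·e^{1234}`, a negative real multiple of `e^{1234}`. -/
theorem stmt_12 (t : ℂ) (ht0 : 0 < ‖t‖) (ht1 : ‖t‖ < 1)
    (r : ℝ) (hr : r ≠ 0)
    (b : Module.Basis (Fin 6) ℝ (Fin 6 → ℝ)) :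
    let e : Fin 6 → ExteriorAlgebra ℝ (Fin 6 → ℝ) := fun i => ExteriorAlgebra.ι ℝ (b i)
    let E : Fin 6 → Fin 6 → ExteriorAlgebra ℝ (Fin 6 → ℝ) := fun i j => e i * e j
    let a : ℝ := ‖t‖
    let t1 : ℝ := t.re
    let t2 : ℝ := t.im
    let ρ : ℝ := a^2 * (1 - a^2)^2 / r^2
    let Ω12 : ExteriorAlgebra ℝ (Fin 6 → ℝ) := ρ⁻¹ •
      (-(a^2) • E 0 1 - (t1 * a) • (E 0 2 - E 1 3) - (t2 * a) • (E 0 3 + E 1 2)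
        + (3 * a^2) • E 2 3)
    let Ω13 : ExteriorAlgebra ℝ (Fin 6 → ℝ) := ρ⁻¹ •
      (-(a^2) • (E 0 2 + E 1 3) + (2 * a) • E 4 5)
    let Ω14 : ExteriorAlgebra ℝ (Fin 6 → ℝ) := ρ⁻¹ •
      (-(t2) • (E 0 2 - E 1 3) - (1 - t1 + a^2) • E 0 3 + (1 + t1 + a^2) • E 1 2)
    let Ω15 : ExteriorAlgebra ℝ (Fin 6 → ℝ) := ρ⁻¹ •
      (-(t2) • (E 0 5 + a • E 2 4) + t1 • (E 1 5 + a • E 3 4))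
    let Ω16 : ExteriorAlgebra ℝ (Fin 6 → ℝ) := ρ⁻¹ •
      (-(t1) • (E 0 5 + a • E 2 4) - t2 • (E 1 5 + a • E 3 4))
    let Ω34 : ExteriorAlgebra ℝ (Fin 6 → ℝ) := ρ⁻¹ •
      ((3 * a^2) • E 0 1 + (t1 * a) • (E 0 2 - E 1 3) + (t2 * a) • (E 0 3 + E 1 2)
        - (a^2) • E 2 3)
    let Ω35 : ExteriorAlgebra ℝ (Fin 6 → ℝ) := ρ⁻¹ •
      (-(t2) • (a • E 0 4 - E 2 5) + t1 • (a • E 1 4 - E 3 5))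
    let Ω36 : ExteriorAlgebra ℝ (Fin 6 → ℝ) := ρ⁻¹ •
      (-(t1) • (a • E 0 4 - E 2 5) - t2 • (a • E 1 4 - E 3 5))
    let Ω23 := -Ω14
    let Ω24 := Ω13
    let Ω25 := -Ω16
    let Ω26 := Ω15
    let Ω45 := -Ω36
    let Ω46 := Ω35
    let Ω56 := -Ω12 - Ω34
    let S : ExteriorAlgebra ℝ (Fin 6 → ℝ) :=
      Ω12*Ω12 + Ω13*Ω13 + Ω14*Ω14 + Ω15*Ω15 + Ω16*Ω16
        + Ω23*Ω23 + Ω24*Ω24 + Ω25*Ω25 + Ω26*Ω26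
        + Ω34*Ω34 + Ω35*Ω35 + Ω36*Ω36 + Ω45*Ω45 + Ω46*Ω46 + Ω56*Ω56
    (S = (-(4 * r^4 * (1 + a^2 + 2*a^4) / (a^4 * (1 - a^2)^4))) • (e 0 * e 1 * e 2 * e 3))
    ∧ (∃ c : ℝ, c < 0 ∧ S = c • (e 0 * e 1 * e 2 * e 3)) := by
  intro e E a t1 t2 ρ Ω12 Ω13 Ω14 Ω15 Ω16 Ω34 Ω35 Ω36 Ω23 Ω24 Ω25 Ω26 Ω45 Ω46 Ω56 S
  have hs : ∀ i, e i * e i = 0 := fun i => ExteriorAlgebra.ι_sq_zero _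
  have ha : ∀ i j, j < i → e i * e j = -(e j * e i) := fun i j _ =>
    eq_neg_of_add_eq_zero_left (ExteriorAlgebra.ι_add_mul_swap _ _)
  have h : t2 ^ 2 = a ^ 2 - t1 ^ 2 := by
    have := Complex.sq_norm t
    rw [Complex.normSq_apply] at this
    simp only [a, t1, t2, this]
    ring
  have a0 : 0 < a := ht0
  have a1 : 0 < 1 - a ^ 2 := by
    have : a < 1 := ht1
    nlinarith
  have hS : S = (-(4 * r^4 * (1 + a^2 + 2*a^4) / (a^4 * (1 - a^2)^4))) •
      (e 0 * e 1 * e 2 * e 3) := by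
    have key := sum_gen e hs ha a t1 t2 ρ⁻¹ h
    refine Eq.trans key ?_
    congr 1
    simp only [ρ]
    have := a1.ne'
    field_simp
  refine ⟨hS, _, ?_, hS⟩
  rw [neg_lt_zero]
  positivity
end

section
/- Let f, γ ∈ ℝ with f² ≤ 1/4, and set c = √(1/4 − f²). In the exterior algebra over ℂ of a complex vector space with basis vectors z₁, z₂, z̄₁, z̄₂, let 𝓕 = i f·z₁∧z̄₁ − i f·z₂∧z̄₂ + e^{iγ}c·z₁∧z̄₂ − e^{−iγ}c·z₂∧z̄₁. Then 𝓕 ∧ 𝓕 = −(1/2)·z₁∧z₂∧z̄₁∧z̄₂. -/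
theorem aux_wedge {A : Type*} [Ring A] [Algebra ℂ A] (z : Fin 4 → A)
    (h0 : ∀ i, z i * z i = 0) (h1 : ∀ i j, z i * z j = -(z j * z i)) (p q r : ℂ)
    (h : 2 * p ^ 2 - 2 * (q * r) = -(1/2)) :
    (p • (z 0 * z 2) - p • (z 1 * z 3) + q • (z 0 * z 3) - r • (z 1 * z 2)) *
    (p • (z 0 * z 2) - p • (z 1 * z 3) + q • (z 0 * z 3) - r • (z 1 * z 2))
      = (-(1/2) : ℂ) • (z 0 * z 1 * z 2 * z 3) := by
  have k0 : ∀ i x, z i * (z i * x) = 0 := fun i x => by rw [← mul_assoc, h0, zero_mul]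
  have k1 : ∀ i j x, z i * (z j * x) = -(z j * (z i * x)) := fun i j x => by
    rw [← mul_assoc, h1, neg_mul, mul_assoc]
  rw [← h]
  simp only [mul_add, add_mul, mul_sub, sub_mul, smul_mul_assoc, mul_smul_comm, mul_assoc,
    h0, k0, h1 3 2,
    k1 1 0, k1 2 0, k1 3 0, k1 2 1, k1 3 1, mul_neg, mul_zero, neg_zero, smul_zero,
    neg_neg]
  module

/-- The abelian instanton curvature `𝓕` of Cardoso et al. satisfies
`𝓕 ∧ 𝓕 = −(1/2)·z₁∧z₂∧z̄₁∧z̄₂`. Indices: `0 = z₁`, `1 = z₂`, `2 = z̄₁`, `3 = z̄₂`. -/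
theorem stmt_13 (f γ : ℝ) (hf : f^2 ≤ 1/4)
    (V : Type*) [AddCommGroup V] [Module ℂ V] (b : Module.Basis (Fin 4) ℂ V) :
    let c : ℝ := Real.sqrt (1/4 - f^2)
    let z : Fin 4 → ExteriorAlgebra ℂ V := fun i => ExteriorAlgebra.ι ℂ (b i)
    let F : ExteriorAlgebra ℂ V :=
      (Complex.I * (f : ℂ)) • (z 0 * z 2) - (Complex.I * (f : ℂ)) • (z 1 * z 3)
        + (Complex.exp (Complex.I * (γ : ℂ)) * (c : ℂ)) • (z 0 * z 3)
        - (Complex.exp (-(Complex.I * (γ : ℂ))) * (c : ℂ)) • (z 1 * z 2)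
    F * F = (-(1/2) : ℂ) • (z 0 * z 1 * z 2 * z 3) := by
  intro c z F
  refine aux_wedge z (fun i => ExteriorAlgebra.ι_sq_zero _) (fun i j => ?_) _ _ _ ?_
  · exact eq_neg_of_add_eq_zero_left (ExteriorAlgebra.ι_add_mul_swap _ _)
  · have hc : (c : ℂ) ^ 2 = 1/4 - (f : ℂ) ^ 2 := by
      have : c ^ 2 = 1/4 - f ^ 2 := Real.sq_sqrt (by linarith)
      rw [← Complex.ofReal_pow, this]; push_cast; ring
    have he : Complex.exp (Complex.I * (γ : ℂ)) * Complex.exp (-(Complex.I * (γ : ℂ))) = 1 := by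
      rw [← Complex.exp_add, add_neg_cancel, Complex.exp_zero]
    linear_combination 2 * (f : ℂ) ^ 2 * Complex.I_sq - 2 * (c : ℂ) ^ 2 * he - 2 * hc
end
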